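/- arXiv:1910.10533 — 6 statements merged into one kernel-verified Lean document; each statement's English description precedes it below -/
import Mathlib

section
/- Let H ∈ ℂ[x,y,z] be a smooth quartic form and let g₄, g₆ ∈ ℂ[s,t,u] be the homogeneous polynomials of degrees 4 and 6 with h₂ = u⁴·g₄ and h₃ = u⁶·g₆. Then for every nonzero (s₀,t₀,u₀) ∈ ℂ³ the following are equivalent: (a) 4·g₄(s₀,t₀,u₀)³ − 27·g₆(s₀,t₀,u₀)² = 0; (b) there exists a nonzero (x₀,y₀,z₀) ∈ ℂ³ with H(x₀,y₀,z₀) = 0 such that (s₀,t₀,u₀) is a nonzero scalar multiple of the gradient (∂H/∂x, ∂H/∂y, ∂H/∂z) evaluated at (x₀,y₀,z₀). In other words, the degree-12 equation 4g₄³ − 27g₆² = 0 defines in the dual plane exactly the projectively dual curve of the quartic H = 0 (the locus of tangent lines s₀x + t₀y + u₀z = 0 of the quartic). -/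
open MvPolynomial

/-- The binary quartic form with coefficients `a, b, c, d, e`. -/
def binaryQuartic (a b c d e x y : ℂ) : ℂ :=
  a * x ^ 4 + b * x ^ 3 * y + c * x ^ 2 * y ^ 2 + d * x * y ^ 3 + e * y ^ 4

/-- The quadratic invariant of a binary quartic form. -/
noncomputable def quarticI (a b c d e : ℂ) : ℂ := (-3 * b * d + 12 * a * e + c ^ 2) / 3

/-- The cubic invariant of a binary quartic form. -/
noncomputable def quarticJ (a b c d e : ℂ) : ℂ :=
  (72 * a * c * e - 27 * a * d ^ 2 - 27 * b ^ 2 * e + 9 * b * c * d - 2 * c ^ 3) / 27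

/-- The discriminant of a binary quartic form. -/
noncomputable def quarticDisc (a b c d e : ℂ) : ℂ :=
  4 * quarticI a b c d e ^ 3 - 27 * quarticJ a b c d e ^ 2

/-- `(x, y)` is a zero of both partial derivatives of the binary quartic. -/
def IsQuarticSingular (a b c d e x y : ℂ) : Prop :=
  4 * a * x ^ 3 + 3 * b * x ^ 2 * y + 2 * c * x * y ^ 2 + d * y ^ 3 = 0 ∧
    b * x ^ 3 + 2 * c * x ^ 2 * y + 3 * d * x * y ^ 2 + 4 * e * y ^ 3 = 0

lemma quarticDisc_reverse (a b c d e : ℂ) :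
    quarticDisc e d c b a = quarticDisc a b c d e := by
  unfold quarticDisc quarticI quarticJ; ring

lemma quarticDisc_eq_zero_of_singular_of_ne_zero {a b c d e x y : ℂ} (hx : x ≠ 0)
    (h : IsQuarticSingular a b c d e x y) : quarticDisc a b c d e = 0 := by
  obtain ⟨h1, h2⟩ := h
  obtain ⟨r, rfl⟩ : ∃ r, y = r * x := ⟨y / x, by field_simp⟩
  have hx3 : x ^ 3 ≠ 0 := pow_ne_zero 3 hx
  have hb : b = -(2 * c * r + 3 * d * r ^ 2 + 4 * e * r ^ 3) := by
    apply mul_left_cancel₀ hx3; linear_combination h2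
  have ha : a = c * r ^ 2 + 2 * d * r ^ 3 + 3 * e * r ^ 4 := by
    apply mul_left_cancel₀ hx3
    rw [hb] at h1
    linear_combination h1 / 4
  subst hb
  subst ha
  unfold quarticDisc quarticI quarticJ
  ring

lemma quarticDisc_eq_zero_of_singular {a b c d e x y : ℂ} (hxy : ¬ (x = 0 ∧ y = 0))
    (h : IsQuarticSingular a b c d e x y) : quarticDisc a b c d e = 0 := by
  by_cases hx : x = 0
  · rw [← quarticDisc_reverse]
    refine quarticDisc_eq_zero_of_singular_of_ne_zero (x := y) (y := x)
      (fun hy => hxy ⟨hx, hy⟩) ⟨?_, ?_⟩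
    · linear_combination h.2
    · linear_combination h.1
  · exact quarticDisc_eq_zero_of_singular_of_ne_zero hx h

lemma exists_root_quadratic (b c : ℂ) : ∃ r : ℂ, r ^ 2 + b * r + c = 0 := by
  obtain ⟨w, hw⟩ := IsAlgClosed.exists_pow_nat_eq (b ^ 2 - 4 * c) (n := 2) (by norm_num)
  exact ⟨(w - b) / 2, by linear_combination hw / 4⟩

lemma exists_root_cubic (b c d : ℂ) : ∃ r : ℂ, r ^ 3 + b * r ^ 2 + c * r + d = 0 := by
  have hdeg : (Polynomial.C 1 * Polynomial.X ^ 3 + Polynomial.C b * Polynomial.X ^ 2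
      + Polynomial.C c * Polynomial.X + Polynomial.C d : Polynomial ℂ).degree = 3 :=
    Polynomial.degree_cubic one_ne_zero
  obtain ⟨r, hr⟩ := IsAlgClosed.exists_root _ (by rw [hdeg]; norm_num)
  exact ⟨r, by simpa [Polynomial.IsRoot] using hr⟩

lemma exists_root_quartic (b c d e : ℂ) :
    ∃ r : ℂ, r ^ 4 + b * r ^ 3 + c * r ^ 2 + d * r + e = 0 := by
  have hdeg : (Polynomial.X ^ 4 + (Polynomial.C b * Polynomial.X ^ 3
      + Polynomial.C c * Polynomial.X ^ 2 + Polynomial.C d * Polynomial.X + Polynomial.C e) :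
        Polynomial ℂ).degree = 4 := by
    have hlt := (Polynomial.degree_cubic_lt (R := ℂ) (a := b) (b := c) (c := d) (d := e))
    rw [Polynomial.degree_add_eq_left_of_degree_lt] <;> rw [Polynomial.degree_X_pow]
    · rfl
    · exact hlt
  obtain ⟨r, hr⟩ := IsAlgClosed.exists_root _ (by rw [hdeg]; norm_num)
  refine ⟨r, ?_⟩
  have : r ^ 4 + (b * r ^ 3 + c * r ^ 2 + d * r + e) = 0 := by
    simpa [Polynomial.IsRoot] using hr
  linear_combination this

lemma exists_factor_cubic (b c d : ℂ) : ∃ p q r : ℂ,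
    b = -(p + q + r) ∧ c = p * q + p * r + q * r ∧ d = -(p * q * r) := by
  obtain ⟨p, hp⟩ := exists_root_cubic b c d
  obtain ⟨q, hq⟩ := exists_root_quadratic (b + p) (c + b * p + p ^ 2)
  refine ⟨p, q, -(b + p + q), by ring, ?_, ?_⟩
  · linear_combination hq
  · linear_combination hp - p * hq

lemma exists_factor_quartic (b c d e : ℂ) : ∃ p q r s : ℂ,
    b = -(p + q + r + s) ∧ c = p * (q + r + s) + (q * r + q * s + r * s) ∧
      d = -(p * (q * r + q * s + r * s) + q * r * s) ∧ e = p * q * r * s := by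
  obtain ⟨p, hp⟩ := exists_root_quartic b c d e
  obtain ⟨q, r, s, h1, h2, h3⟩ := exists_factor_cubic (b + p) (c + b * p + p ^ 2)
    (d + c * p + b * p ^ 2 + p ^ 3)
  refine ⟨p, q, r, s, by linear_combination h1, ?_, ?_, ?_⟩
  · linear_combination h2 - p * h1
  · linear_combination h3 - p * h2
  · linear_combination hp - p * h3

lemma exists_singular_cubic {b c d e : ℂ} (hb : b ≠ 0) (h : quarticDisc 0 b c d e = 0) :
    ∃ x y, ¬ (x = 0 ∧ y = 0) ∧ IsQuarticSingular 0 b c d e x y := by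
  obtain ⟨p, q, r, h1, h2, h3⟩ := exists_factor_cubic (c / b) (d / b) (e / b)
  rw [div_eq_iff hb] at h1 h2 h3
  subst h1 h2 h3
  have key : b ^ 6 * ((p - q) * (p - r) * (q - r)) ^ 2 = 0 := by
    rw [← h]; unfold quarticDisc quarticI quarticJ; ring
  have hroot : p = q ∨ p = r ∨ q = r := by simpa [hb, sub_eq_zero, or_assoc] using key
  rcases hroot with rfl | rfl | rfl
  · exact ⟨p, 1, by simp, by constructor <;> ring⟩
  · exact ⟨p, 1, by simp, by constructor <;> ring⟩
  · exact ⟨q, 1, by simp, by constructor <;> ring⟩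

lemma exists_singular_quartic {a b c d e : ℂ} (ha : a ≠ 0) (h : quarticDisc a b c d e = 0) :
    ∃ x y, ¬ (x = 0 ∧ y = 0) ∧ IsQuarticSingular a b c d e x y := by
  obtain ⟨p, q, r, s, h1, h2, h3, h4⟩ := exists_factor_quartic (b / a) (c / a) (d / a) (e / a)
  rw [div_eq_iff ha] at h1 h2 h3 h4
  subst h1 h2 h3 h4
  have key : a ^ 6 * ((p - q) * (p - r) * (p - s) * (q - r) * (q - s) * (r - s)) ^ 2 = 0 := by
    rw [← h]; unfold quarticDisc quarticI quarticJ; ring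
  have hroot : p = q ∨ p = r ∨ p = s ∨ q = r ∨ q = s ∨ r = s := by
    simpa [ha, sub_eq_zero, or_assoc] using key
  rcases hroot with rfl | rfl | rfl | rfl | rfl | rfl
  · exact ⟨p, 1, by simp, by constructor <;> ring⟩
  · exact ⟨p, 1, by simp, by constructor <;> ring⟩
  · exact ⟨p, 1, by simp, by constructor <;> ring⟩
  · exact ⟨q, 1, by simp, by constructor <;> ring⟩
  · exact ⟨q, 1, by simp, by constructor <;> ring⟩
  · exact ⟨r, 1, by simp, by constructor <;> ring⟩

lemma quarticDisc_eq_zero_iff (a b c d e : ℂ) : quarticDisc a b c d e = 0 ↔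
    ∃ x y, ¬ (x = 0 ∧ y = 0) ∧ IsQuarticSingular a b c d e x y := by
  refine ⟨fun h => ?_, fun ⟨x, y, hxy, h⟩ => quarticDisc_eq_zero_of_singular hxy h⟩
  by_cases ha : a = 0
  · subst ha
    by_cases hb : b = 0
    · exact ⟨1, 0, by simp, by simp [IsQuarticSingular, hb]⟩
    · exact exists_singular_cubic hb h
  · exact exists_singular_quartic ha h

/-- The values of a binary quartic at five points determine its coefficients. -/
lemma binaryQuartic_interpolation {f : ℂ → ℂ → ℂ} {a b c d e : ℂ}
    (hf : ∀ x y, f x y = binaryQuartic a b c d e x y) :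
    a = f 1 0 ∧ e = f 0 1 ∧ c = (f 1 1 + f 1 (-1)) / 2 - f 1 0 - f 0 1 ∧
      b = (f 2 1 - 3 * f 1 1 - f 1 (-1) - 12 * f 1 0 + 3 * f 0 1) / 6 ∧
      d = (6 * f 1 1 - 2 * f 1 (-1) - f 2 1 + 12 * f 1 0 - 3 * f 0 1) / 6 := by
  simp only [hf, binaryQuartic]
  refine ⟨?_, ?_, ?_, ?_, ?_⟩ <;> ring

/-- The invariants of a binary quartic are multiplied by powers of the determinant under a linear
substitution. -/
lemma exists_binaryQuartic_comp (a b c d e α β γ δ : ℂ) : ∃ a' b' c' d' e' : ℂ,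
    (∀ x y, binaryQuartic a b c d e (α * x + β * y) (γ * x + δ * y)
      = binaryQuartic a' b' c' d' e' x y) ∧
    quarticI a' b' c' d' e' = (α * δ - β * γ) ^ 4 * quarticI a b c d e ∧
    quarticJ a' b' c' d' e' = (α * δ - β * γ) ^ 6 * quarticJ a b c d e := by
  refine ⟨a * α ^ 4 + b * α ^ 3 * γ + c * α ^ 2 * γ ^ 2 + d * α * γ ^ 3 + e * γ ^ 4,
    4 * a * α ^ 3 * β + b * (α ^ 3 * δ + 3 * α ^ 2 * β * γ)
      + c * (2 * α ^ 2 * γ * δ + 2 * α * β * γ ^ 2)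
      + d * (3 * α * γ ^ 2 * δ + β * γ ^ 3) + 4 * e * γ ^ 3 * δ,
    6 * a * α ^ 2 * β ^ 2 + b * (3 * α ^ 2 * β * δ + 3 * α * β ^ 2 * γ)
      + c * (α ^ 2 * δ ^ 2 + 4 * α * β * γ * δ + β ^ 2 * γ ^ 2)
      + d * (3 * α * γ * δ ^ 2 + 3 * β * γ ^ 2 * δ) + 6 * e * γ ^ 2 * δ ^ 2,
    4 * a * α * β ^ 3 + b * (3 * α * β ^ 2 * δ + β ^ 3 * γ)
      + c * (2 * α * β * δ ^ 2 + 2 * β ^ 2 * γ * δ)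
      + d * (α * δ ^ 3 + 3 * β * γ * δ ^ 2) + 4 * e * γ * δ ^ 3,
    a * β ^ 4 + b * β ^ 3 * δ + c * β ^ 2 * δ ^ 2 + d * β * δ ^ 3 + e * δ ^ 4, ?_, ?_, ?_⟩
  · intro x y; unfold binaryQuartic; ring
  · unfold quarticI; ring
  · unfold quarticJ; ring

/-- The derivative of a polynomial function along a line. -/
lemma hasDerivAt_eval_line {σ : Type*} [Fintype σ] (H : MvPolynomial σ ℂ) (q v : σ → ℂ) :
    HasDerivAt (fun τ : ℂ => eval (q + τ • v) H) (∑ k, eval q (pderiv k H) * v k) 0 := by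
  classical
  induction H using MvPolynomial.induction_on with
  | C a => simpa using hasDerivAt_const (0 : ℂ) a
  | add P Q hP hQ =>
    simp only [map_add, add_mul, Finset.sum_add_distrib]
    exact hP.fun_add hQ
  | mul_X P i hP =>
    have hi : HasDerivAt (fun τ : ℂ => q i + τ * v i) (v i) 0 := by
      simpa using ((hasDerivAt_id (0 : ℂ)).mul_const (v i)).const_add (q i)
    have h := hP.fun_mul hi
    simp only [zero_smul, add_zero, zero_mul] at h
    have hsum : ∑ k, eval q (pderiv k (P * X i)) * v k
        = (∑ k, eval q (pderiv k P) * v k) * q i + eval q P * v i := by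
      simp only [pderiv_mul, pderiv_X, map_add, map_mul, eval_X, add_mul, Finset.sum_add_distrib,
        Finset.sum_mul]
      congr 1
      · exact Finset.sum_congr rfl fun k _ => by ring
      · rw [Finset.sum_eq_single i]
        · simp
        · intro k _ hk
          simp [hk.symm]
        · simp
    rw [hsum]
    simpa using h

/-- The partial derivatives of the restriction of a form to a line. -/
lemma isQuarticSingular_iff {H : MvPolynomial (Fin 3) ℂ} {A B : Fin 3 → ℂ} {a b c d e : ℂ}
    (hf : ∀ x y : ℂ, eval (x • A + y • B) H = binaryQuartic a b c d e x y) (x y : ℂ) :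
    IsQuarticSingular a b c d e x y ↔
      (fun k => eval (x • A + y • B) (pderiv k H)) ⬝ᵥ A = 0 ∧
        (fun k => eval (x • A + y • B) (pderiv k H)) ⬝ᵥ B = 0 := by
  have hxd : HasDerivAt (fun τ : ℂ => x + τ) 1 0 := (hasDerivAt_id (0 : ℂ)).const_add x
  have hyd : HasDerivAt (fun τ : ℂ => y + τ) 1 0 := (hasDerivAt_id (0 : ℂ)).const_add y
  have hA := hasDerivAt_eval_line H (x • A + y • B) A
  have hB := hasDerivAt_eval_line H (x • A + y • B) B
  have eA : (fun τ : ℂ => eval (x • A + y • B + τ • A) H) =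
      fun τ => a * (x + τ) ^ 4 + b * y * (x + τ) ^ 3 + c * y ^ 2 * (x + τ) ^ 2
        + d * y ^ 3 * (x + τ) + e * y ^ 4 := by
    ext τ
    rw [show x • A + y • B + τ • A = (x + τ) • A + y • B by module, hf, binaryQuartic]
    ring
  have eB : (fun τ : ℂ => eval (x • A + y • B + τ • B) H) =
      fun τ => e * (y + τ) ^ 4 + d * x * (y + τ) ^ 3 + c * x ^ 2 * (y + τ) ^ 2
        + b * x ^ 3 * (y + τ) + a * x ^ 4 := by
    ext τ
    rw [show x • A + y • B + τ • B = x • A + (y + τ) • B by module, hf, binaryQuartic]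
    ring
  rw [eA] at hA
  rw [eB] at hB
  have uA := hA.unique (((((hxd.pow 4).const_mul a).add ((hxd.pow 3).const_mul (b * y))).add
    ((hxd.pow 2).const_mul (c * y ^ 2))).add (hxd.const_mul (d * y ^ 3)) |>.add_const (e * y ^ 4))
  have uB := hB.unique (((((hyd.pow 4).const_mul e).add ((hyd.pow 3).const_mul (d * x))).add
    ((hyd.pow 2).const_mul (c * x ^ 2))).add (hyd.const_mul (b * x ^ 3)) |>.add_const (a * x ^ 4))
  simp only [dotProduct, uA, uB, IsQuarticSingular]
  norm_num
  ring_nf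

/-- `A` and `B` span the line `p`, on which `H` restricts to the given binary quartic. -/
structure IsLineRestriction (H : MvPolynomial (Fin 3) ℂ) (p A B : Fin 3 → ℂ)
    (a b c d e : ℂ) : Prop where
  perp_left : p ⬝ᵥ A = 0
  perp_right : p ⬝ᵥ B = 0
  span : ∀ q, p ⬝ᵥ q = 0 → ∃ x y : ℂ, q = x • A + y • B
  indep : ∀ x y : ℂ, x • A + y • B = 0 → x = 0 ∧ y = 0
  normal : ∀ g, g ⬝ᵥ A = 0 → g ⬝ᵥ B = 0 → ∃ l : ℂ, g = l • p
  restrict : ∀ x y : ℂ, eval (x • A + y • B) H = binaryQuartic a b c d e x y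

/-- The discriminant of the restriction of a smooth quartic to a line vanishes exactly when the line
is tangent to the quartic. -/
lemma IsLineRestriction.disc_eq_zero_iff {H : MvPolynomial (Fin 3) ℂ} (hH4 : H.IsHomogeneous 4)
    (hHsmooth : ¬ ∃ p : Fin 3 → ℂ, p ≠ 0 ∧ eval p H = 0 ∧
      ∀ k : Fin 3, eval p (pderiv k H) = 0)
    {p A B : Fin 3 → ℂ} {a b c d e : ℂ} (h : IsLineRestriction H p A B a b c d e) :
    quarticDisc a b c d e = 0 ↔ ∃ q : Fin 3 → ℂ, q ≠ 0 ∧ eval q H = 0 ∧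
      ∃ c : ℂ, c ≠ 0 ∧ p = c • (fun k : Fin 3 => eval q (pderiv k H)) := by
  rw [quarticDisc_eq_zero_iff]
  constructor
  · rintro ⟨x, y, hxy, hs⟩
    have hq : x • A + y • B ≠ 0 := fun h0 => hxy (h.indep x y h0)
    have hH : eval (x • A + y • B) H = 0 := by
      rw [h.restrict, binaryQuartic]
      linear_combination x / 4 * hs.1 + y / 4 * hs.2
    obtain ⟨hA, hB⟩ := (isQuarticSingular_iff h.restrict x y).1 hs
    obtain ⟨l, hl⟩ := h.normal _ hA hB
    have hl0 : l ≠ 0 := by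
      rintro rfl
      exact hHsmooth ⟨_, hq, hH, fun k => by simpa using congrFun hl k⟩
    exact ⟨_, hq, hH, l⁻¹, inv_ne_zero hl0, by rw [hl, inv_smul_smul₀ hl0]⟩
  · rintro ⟨q, hq, hH, l, hl, hpl⟩
    have hgrad : (fun k => eval q (pderiv k H)) = l⁻¹ • p := by rw [hpl, inv_smul_smul₀ hl]
    have hpq : p ⬝ᵥ q = 0 := by
      have euler := congrArg (eval q) hH4.sum_X_mul_pderiv
      simp only [map_sum, map_mul, eval_X, map_nsmul, hH, smul_zero] at euler
      rw [hpl, smul_dotProduct, dotProduct_comm]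
      simp [dotProduct, euler]
    obtain ⟨x, y, rfl⟩ := h.span q hpq
    refine ⟨x, y, ?_, (isQuarticSingular_iff h.restrict x y).2 ?_⟩
    · rintro ⟨rfl, rfl⟩
      simp at hq
    · rw [hgrad]
      simp [smul_dotProduct, h.perp_left, h.perp_right]

/-- The equality of `f` and `g` extends over an isolated point. -/
lemma eq_of_continuous_of_eq_off_zero {f g : ℂ → ℂ} (hf : Continuous f) (hg : Continuous g)
    (h : ∀ u, u ≠ 0 → f u = g u) : f 0 = g 0 :=
  congrFun (Continuous.ext_on (dense_compl_singleton (0 : ℂ)) hf hg fun u hu => h u hu) 0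

/-- A family of forms varying continuously that restrict to binary quartics with prescribed
invariants away from `0` does so at `0`. -/
lemma exists_binaryQuartic_at_zero {F : ℂ → ℂ → ℂ → ℂ} {G₄ G₆ : ℂ → ℂ}
    (hF : ∀ x y, Continuous fun u => F u x y) (hG₄ : Continuous G₄) (hG₆ : Continuous G₆)
    (h : ∀ u, u ≠ 0 → ∃ a b c d e : ℂ, (∀ x y, F u x y = binaryQuartic a b c d e x y) ∧
      quarticI a b c d e = G₄ u ∧ quarticJ a b c d e = G₆ u) :
    ∃ a b c d e : ℂ, (∀ x y, F 0 x y = binaryQuartic a b c d e x y) ∧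
      quarticI a b c d e = G₄ 0 ∧ quarticJ a b c d e = G₆ 0 := by
  obtain ⟨a, ha⟩ : ∃ a : ℂ → ℂ, a = fun u => F u 1 0 := ⟨_, rfl⟩
  obtain ⟨e, he⟩ : ∃ e : ℂ → ℂ, e = fun u => F u 0 1 := ⟨_, rfl⟩
  obtain ⟨c, hc⟩ : ∃ c : ℂ → ℂ, c = fun u => (F u 1 1 + F u 1 (-1)) / 2 - F u 1 0 - F u 0 1 :=
    ⟨_, rfl⟩
  obtain ⟨b, hb⟩ : ∃ b : ℂ → ℂ, b = fun u =>
    (F u 2 1 - 3 * F u 1 1 - F u 1 (-1) - 12 * F u 1 0 + 3 * F u 0 1) / 6 := ⟨_, rfl⟩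
  obtain ⟨d, hd⟩ : ∃ d : ℂ → ℂ, d = fun u =>
    (6 * F u 1 1 - 2 * F u 1 (-1) - F u 2 1 + 12 * F u 1 0 - 3 * F u 0 1) / 6 := ⟨_, rfl⟩
  have ca : Continuous a := by rw [ha]; fun_prop
  have cb : Continuous b := by rw [hb]; fun_prop
  have cc : Continuous c := by rw [hc]; fun_prop
  have cd : Continuous d := by rw [hd]; fun_prop
  have ce : Continuous e := by rw [he]; fun_prop
  have key : ∀ u, u ≠ 0 →
      (∀ x y, F u x y = binaryQuartic (a u) (b u) (c u) (d u) (e u) x y) ∧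
      quarticI (a u) (b u) (c u) (d u) (e u) = G₄ u ∧
      quarticJ (a u) (b u) (c u) (d u) (e u) = G₆ u := by
    intro u hu
    obtain ⟨a', b', c', d', e', hf, hI, hJ⟩ := h u hu
    obtain ⟨h1, h2, h3, h4, h5⟩ := binaryQuartic_interpolation hf
    have ea : a u = a' := by rw [ha, h1]
    have eb : b u = b' := by rw [hb, h4]
    have ec : c u = c' := by rw [hc, h3]
    have ed : d u = d' := by rw [hd, h5]
    have ee : e u = e' := by rw [he, h2]
    rw [ea, eb, ec, ed, ee]
    exact ⟨hf, hI, hJ⟩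
  refine ⟨a 0, b 0, c 0, d 0, e 0, fun x y => ?_, ?_, ?_⟩
  · exact eq_of_continuous_of_eq_off_zero (hF x y)
      (g := fun u => binaryQuartic (a u) (b u) (c u) (d u) (e u) x y)
      (by unfold binaryQuartic; fun_prop) fun u hu => (key u hu).1 x y
  · exact eq_of_continuous_of_eq_off_zero
      (f := fun u => quarticI (a u) (b u) (c u) (d u) (e u))
      (by unfold quarticI; fun_prop) hG₄ fun u hu => (key u hu).2.1
  · exact eq_of_continuous_of_eq_off_zero
      (f := fun u => quarticJ (a u) (b u) (c u) (d u) (e u))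
      (by unfold quarticJ; fun_prop) hG₆ fun u hu => (key u hu).2.2

/-- For a smooth plane quartic `H`, the degree-12 equation `4g₄³ − 27g₆² = 0` defines exactly
the projectively dual curve of `H = 0` in the dual plane: a nonzero `(s₀,t₀,u₀)` satisfies it
iff `(s₀,t₀,u₀)` is a nonzero scalar multiple of the gradient of `H` at some nonzero point of
the quartic `H = 0`. -/
theorem stmt_12 (H : MvPolynomial (Fin 3) ℂ) (hH4 : H.IsHomogeneous 4)
    (hHsmooth : ¬ ∃ p : Fin 3 → ℂ, p ≠ 0 ∧ eval p H = 0 ∧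
      ∀ k : Fin 3, eval p (pderiv k H) = 0)
    (b₀ b₁ b₂ b₃ b₄ : MvPolynomial (Fin 3) ℂ)
    (hb : ∀ s t u x y : ℂ,
      eval ![x * u, y * u, -(s * x + t * y)] H
        = eval ![s, t, u] b₀ * x ^ 4 + eval ![s, t, u] b₁ * x ^ 3 * y
          + eval ![s, t, u] b₂ * x ^ 2 * y ^ 2 + eval ![s, t, u] b₃ * x * y ^ 3
          + eval ![s, t, u] b₄ * y ^ 4)
    (h₂ h₃ : MvPolynomial (Fin 3) ℂ)
    (hh₂ : h₂ = C (1 / 3 : ℂ) * (-3 * b₁ * b₃ + 12 * b₀ * b₄ + b₂ ^ 2))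
    (hh₃ : h₃ = C (1 / 27 : ℂ) * (72 * b₀ * b₂ * b₄ - 27 * b₀ * b₃ ^ 2 - 27 * b₁ ^ 2 * b₄
      + 9 * b₁ * b₂ * b₃ - 2 * b₂ ^ 3))
    (g₄ g₆ : MvPolynomial (Fin 3) ℂ)
    (hg₄h : g₄.IsHomogeneous 4) (hg₆h : g₆.IsHomogeneous 6)
    (hfac₄ : h₂ = X 2 ^ 4 * g₄) (hfac₆ : h₃ = X 2 ^ 6 * g₆)
    (p : Fin 3 → ℂ) (hp : p ≠ 0) :
    4 * eval p g₄ ^ 3 - 27 * eval p g₆ ^ 2 = 0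
      ↔ ∃ q : Fin 3 → ℂ, q ≠ 0 ∧ eval q H = 0 ∧
          ∃ c : ℂ, c ≠ 0 ∧ p = c • (fun k : Fin 3 => eval q (pderiv k H)) := by
  have hI : ∀ s t u : ℂ, quarticI (eval ![s, t, u] b₀) (eval ![s, t, u] b₁) (eval ![s, t, u] b₂)
      (eval ![s, t, u] b₃) (eval ![s, t, u] b₄) = u ^ 4 * eval ![s, t, u] g₄ := by
    intro s t u
    have h := congrArg (eval ![s, t, u]) (hh₂.symm.trans hfac₄)
    simp at h
    rw [← h, quarticI]
    ring
  have hJ : ∀ s t u : ℂ, quarticJ (eval ![s, t, u] b₀) (eval ![s, t, u] b₁) (eval ![s, t, u] b₂)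
      (eval ![s, t, u] b₃) (eval ![s, t, u] b₄) = u ^ 6 * eval ![s, t, u] g₆ := by
    intro s t u
    have h := congrArg (eval ![s, t, u]) (hh₃.symm.trans hfac₆)
    simp at h
    rw [← h, quarticJ]
    ring
  obtain ⟨s, t, u, rfl⟩ : ∃ s t u : ℂ, p = ![s, t, u] :=
    ⟨p 0, p 1, p 2, by ext i; fin_cases i <;> rfl⟩
  by_cases hu : u = 0
  · subst hu
    obtain ⟨m, n, hmn⟩ : ∃ m n : ℂ, s * m + t * n = 1 := by
      by_cases hs : s = 0
      · have ht : t ≠ 0 := by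
          rintro rfl
          exact hp (by ext i; fin_cases i <;> simp [hs])
        exact ⟨0, t⁻¹, by field_simp; ring⟩
      · exact ⟨s⁻¹, 0, by field_simp; ring⟩
    obtain ⟨a, b, c, d, e, hf, hI0, hJ0⟩ := exists_binaryQuartic_at_zero
      (F := fun u x y => eval (x • ![t, -s, 0] + y • ![u * m, u * n, -1]) H)
      (G₄ := fun u => eval ![s, t, u] g₄) (G₆ := fun u => eval ![s, t, u] g₆)
      (fun x y => (MvPolynomial.continuous_eval H).comp (by fun_prop))
      ((MvPolynomial.continuous_eval g₄).comp (by fun_prop))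
      ((MvPolynomial.continuous_eval g₆).comp (by fun_prop)) (by
        intro u hu
        obtain ⟨a, b, c, d, e, hf, hI', hJ'⟩ := exists_binaryQuartic_comp
          (eval ![s, t, u] b₀) (eval ![s, t, u] b₁) (eval ![s, t, u] b₂)
          (eval ![s, t, u] b₃) (eval ![s, t, u] b₄) (t / u) m (-s / u) n
        have hdet : t / u * n - m * (-s / u) = u⁻¹ := by
          field_simp
          linear_combination hmn
        rw [hdet, hI] at hI'
        rw [hdet, hJ] at hJ'
        refine ⟨a, b, c, d, e, fun x y => ?_, ?_, ?_⟩
        · rw [← hf, binaryQuartic, ← hb]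
          congr 2
          ext i
          fin_cases i
          · simp; field_simp
          · simp; field_simp
          · simp; field_simp; linear_combination (y * u) * hmn
        · rw [hI']; field_simp
        · rw [hJ']; field_simp)
    have hline : IsLineRestriction H ![s, t, 0] ![t, -s, 0] ![0, 0, -1] a b c d e := by
      refine ⟨?_, ?_, ?_, ?_, ?_, ?_⟩
      · simp [dotProduct, Fin.sum_univ_three]; ring
      · simp [dotProduct, Fin.sum_univ_three]
      · intro q hq
        simp [dotProduct, Fin.sum_univ_three] at hq
        refine ⟨n * q 0 - m * q 1, -q 2, ?_⟩
        ext i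
        fin_cases i
        · simp; linear_combination (-q 0) * hmn + m * hq
        · simp; linear_combination (-q 1) * hmn + n * hq
        · simp
      · intro x y hxy
        have h0 := congrFun hxy 0
        have h1 := congrFun hxy 1
        have h2 := congrFun hxy 2
        simp at h0 h1 h2
        refine ⟨?_, h2⟩
        rcases h0 with h0 | h0
        · exact h0
        · rcases h1 with h1 | h1
          · exact h1
          · simp [h0, h1] at hmn
      · intro g hA hB
        simp [dotProduct, Fin.sum_univ_three] at hA hB
        refine ⟨g 0 * m + g 1 * n, ?_⟩
        ext i
        fin_cases i
        · simp; linear_combination (-g 0) * hmn + n * hA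
        · simp; linear_combination (-g 1) * hmn - m * hA
        · simpa using hB
      · simpa using hf
    rw [← hline.disc_eq_zero_iff hH4 hHsmooth, quarticDisc, hI0, hJ0]
  · have hline : IsLineRestriction H ![s, t, u] ![u, 0, -s] ![0, u, -t]
        (eval ![s, t, u] b₀) (eval ![s, t, u] b₁) (eval ![s, t, u] b₂)
          (eval ![s, t, u] b₃) (eval ![s, t, u] b₄) := by
      refine ⟨?_, ?_, ?_, ?_, ?_, ?_⟩
      · simp [dotProduct, Fin.sum_univ_three]; ring
      · simp [dotProduct, Fin.sum_univ_three]; ring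
      · intro q hq
        simp [dotProduct, Fin.sum_univ_three] at hq
        refine ⟨q 0 / u, q 1 / u, ?_⟩
        ext i
        fin_cases i
        · simp; field_simp
        · simp; field_simp
        · simp; field_simp; linear_combination hq
      · intro x y hxy
        have h0 := congrFun hxy 0
        have h1 := congrFun hxy 1
        simpa [hu] using And.intro h0 h1
      · intro g hA hB
        simp [dotProduct, Fin.sum_univ_three] at hA hB
        refine ⟨g 2 / u, ?_⟩
        ext i
        fin_cases i
        · simp; field_simp; linear_combination hA
        · simp; field_simp; linear_combination hB
        · simp; field_simp
      · intro x y
        rw [binaryQuartic, ← hb]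
        congr 2
        ext i
        fin_cases i
        · simp
        · simp
        · simp; ring
    rw [← hline.disc_eq_zero_iff hH4 hHsmooth, quarticDisc, hI, hJ]
    have hk : 4 * (u ^ 4 * eval ![s, t, u] g₄) ^ 3 - 27 * (u ^ 6 * eval ![s, t, u] g₆) ^ 2
        = u ^ 12 * (4 * eval ![s, t, u] g₄ ^ 3 - 27 * eval ![s, t, u] g₆ ^ 2) := by ring
    rw [hk, mul_eq_zero_iff_left (pow_ne_zero 12 hu)]
end

section
/- Let g₄, g₆ ∈ ℂ[s,t,u] be homogeneous of degrees 4 and 6, let G = 4g₄³ − 27g₆², and let F = −w² + v³ − g₄(s,t,u)·v + g₆(s,t,u) ∈ ℂ[s,t,u,v,w]. Then for every nonzero a = (a₀,a₁,a₂) ∈ ℂ³ the following are equivalent: (a) g₆(a) ≠ 0, G(a) = 0, and all three partial derivatives of G vanish at a; (b) g₄(a) ≠ 0 and all five partial derivatives of F (with respect to s, t, u, v, w) vanish at the point (a₀, a₁, a₂, 3g₆(a)/(2g₄(a)), 0). This is the one-to-one correspondence between the singular points of the discriminant curve G = 0 lying off the sextic g₆ = 0 and the singular points of the double Veronese cone F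 = 0 lying off the section v = 0. -/
open MvPolynomial

theorem MvPolynomial.pderiv_rename_of_notMem_range {R σ τ : Type*} [CommSemiring R] {f : σ → τ}
    {i : τ} (hi : i ∉ Set.range f) (p : MvPolynomial σ R) : pderiv i (rename f p) = 0 := by
  classical
  refine pderiv_eq_zero_of_notMem_vars fun h => hi ?_
  obtain ⟨x, -, rfl⟩ := mem_vars_rename f p h
  exact ⟨x, rfl⟩

/-- One-to-one correspondence between the singular points of the discriminant curve
`G = 4g₄³ − 27g₆² = 0` lying off the sextic `g₆ = 0` and the singular points of the double
Veronese cone `−w² + v³ − g₄v + g₆ = 0` lying off the section `v = 0`. -/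
theorem stmt_13 (g₄ g₆ : MvPolynomial (Fin 3) ℂ)
    (hg₄ : g₄.IsHomogeneous 4) (hg₆ : g₆.IsHomogeneous 6)
    (G : MvPolynomial (Fin 3) ℂ) (hG : G = 4 * g₄ ^ 3 - 27 * g₆ ^ 2)
    (F : MvPolynomial (Fin 5) ℂ)
    (hF : F = -X 4 ^ 2 + X 3 ^ 3
      - rename (Fin.castLE (by norm_num : (3 : ℕ) ≤ 5)) g₄ * X 3
      + rename (Fin.castLE (by norm_num : (3 : ℕ) ≤ 5)) g₆)
    (a : Fin 3 → ℂ) (ha : a ≠ 0) :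
    (eval a g₆ ≠ 0 ∧ eval a G = 0 ∧ ∀ k : Fin 3, eval a (pderiv k G) = 0)
      ↔ (eval a g₄ ≠ 0 ∧ ∀ k : Fin 5,
          eval ![a 0, a 1, a 2, 3 * eval a g₆ / (2 * eval a g₄), 0] (pderiv k F) = 0) := by
  set c : Fin 3 → Fin 5 := Fin.castLE (by norm_num : (3 : ℕ) ≤ 5) with hc
  have hinj : Function.Injective c := Fin.castLE_injective _
  set v : ℂ := 3 * eval a g₆ / (2 * eval a g₄) with hv
  set x : Fin 5 → ℂ := ![a 0, a 1, a 2, v, 0] with hx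
  have hxc : x ∘ c = a := by
    ext i
    fin_cases i <;> rfl
  have h3 : (3 : Fin 5) ∉ Set.range c := by
    rintro ⟨i, hi⟩
    fin_cases i <;> simp [hc, Fin.ext_iff] at hi
  have h4 : (4 : Fin 5) ∉ Set.range c := by
    rintro ⟨i, hi⟩
    fin_cases i <;> simp [hc, Fin.ext_iff] at hi
  have hne3 (i : Fin 3) : (3 : Fin 5) ≠ c i := fun h => h3 ⟨i, h.symm⟩
  have hne4 (i : Fin 3) : (4 : Fin 5) ≠ c i := fun h => h4 ⟨i, h.symm⟩
  have hx3 : x 3 = v := rfl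
  have hx4 : x 4 = 0 := rfl
  have F4 : eval x (pderiv 4 F) = 0 := by
    simp [hF, pderiv_rename_of_notMem_range h4, Derivation.leibniz_pow, hx4]
  have F3 : eval x (pderiv 3 F) = 3 * v ^ 2 - eval a g₄ := by
    simp [hF, pderiv_rename_of_notMem_range h3, Derivation.leibniz_pow, hx3,
      eval_rename, hxc]
  have Fc (i : Fin 3) : eval x (pderiv (c i) F) =
      eval a (pderiv i g₆) - v * eval a (pderiv i g₄) := by
    simp [hF, pderiv_rename hinj, pderiv_X_of_ne (hne3 i), pderiv_X_of_ne (hne4 i),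
      Derivation.leibniz_pow, hx3, eval_rename, hxc]
    ring
  have hFall : (∀ k, eval x (pderiv k F) = 0) ↔
      3 * v ^ 2 = eval a g₄ ∧ ∀ i, eval a (pderiv i g₆) = v * eval a (pderiv i g₄) := by
    constructor
    · intro h
      exact ⟨sub_eq_zero.mp (F3 ▸ h 3), fun i => sub_eq_zero.mp (Fc i ▸ h (c i))⟩
    · rintro ⟨h, h'⟩ k
      have hk (i : Fin 3) : eval x (pderiv (c i) F) = 0 := by rw [Fc, h', sub_self]
      fin_cases k
      · exact hk 0
      · exact hk 1
      · exact hk 2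
      · exact F3.trans (sub_eq_zero.mpr h)
      · exact F4
  have G0 : eval a G = 4 * eval a g₄ ^ 3 - 27 * eval a g₆ ^ 2 := by
    simp [hG]
  have Gk (k : Fin 3) : eval a (pderiv k G) = 12 * eval a g₄ ^ 2 * eval a (pderiv k g₄)
      - 54 * eval a g₆ * eval a (pderiv k g₆) := by
    have e4 : (4 : MvPolynomial (Fin 3) ℂ) = C 4 := (map_ofNat C 4).symm
    have e27 : (27 : MvPolynomial (Fin 3) ℂ) = C 27 := (map_ofNat C 27).symm
    rw [hG, e4, e27]
    simp [Derivation.leibniz_pow]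
    ring
  rw [hFall, G0]
  simp only [Gk]
  generalize eval a g₄ = A at *
  generalize eval a g₆ = B at *
  constructor
  · rintro ⟨hB, h0, hd⟩
    have hA : A ≠ 0 := by
      rintro rfl
      simp [hB] at h0
    have hvA : 2 * A * v = 3 * B := by rw [hv]; field_simp
    refine ⟨hA, ?_, fun i => ?_⟩
    · apply mul_left_cancel₀ (pow_ne_zero 2 hA)
      linear_combination (3 / 4 : ℂ) * (2 * A * v + 3 * B) * hvA - (1 / 4 : ℂ) * h0
    · apply mul_left_cancel₀ (mul_ne_zero hA hB)
      linear_combination (-A / 54) * hd i - (B / 2) * eval a (pderiv i g₄) * hvA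
        + (1 / 18 : ℂ) * eval a (pderiv i g₄) * h0
  · rintro ⟨hA, h0, hd⟩
    have hvA : 2 * A * v = 3 * B := by rw [hv]; field_simp
    have h1 : 4 * A ^ 3 - 27 * B ^ 2 = 0 := by
      linear_combination 3 * (2 * A * v + 3 * B) * hvA - 4 * A ^ 2 * h0
    refine ⟨?_, h1, fun i => ?_⟩
    · rintro rfl
      simp [hA] at h1
    · apply mul_left_cancel₀ hA
      linear_combination (-54 * A * B) * hd i - 27 * B * eval a (pderiv i g₄) * hvA
        + 3 * eval a (pderiv i g₄) * h1
end

section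
/- For λ ∈ ℂ, the quartic form F_λ = x⁴ + y⁴ + z⁴ + λ(y²z² + x²z² + x²y²) ∈ ℂ[x,y,z] is smooth (there is no nonzero (x,y,z) ∈ ℂ³ at which F_λ and all three of its partial derivatives vanish) if and only if λ ∉ {2, −2, −1}. -/
open MvPolynomial

/-- The critical equations of the quartic force the first coordinate to vanish unless
`λ ∈ {2, −2, −1}`. -/
theorem eq_zero_of_critical {lam x y z : ℂ} (h2 : lam ≠ 2) (hm2 : lam ≠ -2) (hm1 : lam ≠ -1)
    (hx : x * (2 * x ^ 2 + lam * (y ^ 2 + z ^ 2)) = 0)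
    (hy : y * (2 * y ^ 2 + lam * (x ^ 2 + z ^ 2)) = 0)
    (hz : z * (2 * z ^ 2 + lam * (x ^ 2 + y ^ 2)) = 0) : x = 0 := by
  have e2 : 2 - lam ≠ 0 := sub_ne_zero.mpr h2.symm
  have em2 : 2 + lam ≠ 0 := fun h => hm2 (by linear_combination h)
  have em1 : 1 + lam ≠ 0 := fun h => hm1 (by linear_combination h)
  by_contra hx0
  have hx' := (mul_eq_zero.mp hx).resolve_left hx0
  have hxx : x ^ 2 ≠ 0 := pow_ne_zero 2 hx0
  rcases mul_eq_zero.mp hy with rfl | hy' <;> rcases mul_eq_zero.mp hz with rfl | hz'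
  · exact hxx (by linear_combination hx' / 2)
  · exact mul_ne_zero (mul_ne_zero e2 em2) hxx (by linear_combination 2 * hx' - lam * hz')
  · exact mul_ne_zero (mul_ne_zero e2 em2) hxx (by linear_combination 2 * hx' - lam * hy')
  · have hab : x ^ 2 - y ^ 2 = 0 :=
      (mul_eq_zero.mp (by linear_combination hx' - hy' :
        (2 - lam) * (x ^ 2 - y ^ 2) = 0)).resolve_left e2
    have hac : x ^ 2 - z ^ 2 = 0 :=
      (mul_eq_zero.mp (by linear_combination hx' - hz' :
        (2 - lam) * (x ^ 2 - z ^ 2) = 0)).resolve_left e2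
    exact mul_ne_zero em1 hxx (by linear_combination (hx' + lam * hab + lam * hac) / 2)

/-- The `S₄`-invariant plane quartic `x⁴ + y⁴ + z⁴ + λ(y²z² + x²z² + x²y²)` is smooth if and
only if `λ ∉ {2, −2, −1}`. -/
theorem stmt_15 (lam : ℂ) (F : MvPolynomial (Fin 3) ℂ)
    (hF : F = X 0 ^ 4 + X 1 ^ 4 + X 2 ^ 4
      + C lam * (X 1 ^ 2 * X 2 ^ 2 + X 0 ^ 2 * X 2 ^ 2 + X 0 ^ 2 * X 1 ^ 2)) :
    (¬ ∃ p : Fin 3 → ℂ, p ≠ 0 ∧ eval p F = 0 ∧ ∀ k : Fin 3, eval p (pderiv k F) = 0)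
      ↔ (lam ≠ 2 ∧ lam ≠ -2 ∧ lam ≠ -1) := by
  have h0 (p : Fin 3 → ℂ) : eval p (pderiv 0 F) =
      2 * (p 0 * (2 * p 0 ^ 2 + lam * (p 1 ^ 2 + p 2 ^ 2))) := by
    simp [hF, pderiv_X]
    ring
  have h1 (p : Fin 3 → ℂ) : eval p (pderiv 1 F) =
      2 * (p 1 * (2 * p 1 ^ 2 + lam * (p 0 ^ 2 + p 2 ^ 2))) := by
    simp [hF, pderiv_X]
    ring
  have h2 (p : Fin 3 → ℂ) : eval p (pderiv 2 F) =
      2 * (p 2 * (2 * p 2 ^ 2 + lam * (p 0 ^ 2 + p 1 ^ 2))) := by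
    simp [hF, pderiv_X]
    ring
  have hE (p : Fin 3 → ℂ) : eval p F = p 0 ^ 4 + p 1 ^ 4 + p 2 ^ 4
      + lam * (p 1 ^ 2 * p 2 ^ 2 + p 0 ^ 2 * p 2 ^ 2 + p 0 ^ 2 * p 1 ^ 2) := by
    simp [hF]
  have hall (P : Fin 3 → Prop) : (∀ k, P k) ↔ P 0 ∧ P 1 ∧ P 2 :=
    ⟨fun h => ⟨h 0, h 1, h 2⟩, fun ⟨a, b, c⟩ k => by fin_cases k <;> assumption⟩
  simp only [hall, h0, h1, h2, hE]
  constructor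
  · intro h
    refine ⟨?_, ?_, ?_⟩ <;> rintro rfl <;> apply h
    · refine ⟨![1, Complex.I, 0], fun h => by simpa using congrFun h 0, ?_⟩
      have hI : Complex.I ^ 4 = 1 := Complex.I_pow_four
      simp only [Matrix.cons_val]
      norm_num [hI]
    · refine ⟨![1, 1, 0], fun h => by simpa using congrFun h 0, ?_⟩
      simp only [Matrix.cons_val]
      norm_num
    · refine ⟨![1, 1, 1], fun h => by simpa using congrFun h 0, ?_⟩
      simp only [Matrix.cons_val]
      norm_num
  · rintro ⟨n2, nm2, nm1⟩ ⟨p, hp, -, e0, e1, e2⟩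
    apply hp
    have e0 := (mul_eq_zero.mp e0).resolve_left two_ne_zero
    have e1 := (mul_eq_zero.mp e1).resolve_left two_ne_zero
    have e2 := (mul_eq_zero.mp e2).resolve_left two_ne_zero
    refine funext ((hall _).2 ⟨?_, ?_, ?_⟩)
    · exact eq_zero_of_critical n2 nm2 nm1 e0 e1 e2
    · exact eq_zero_of_critical n2 nm2 nm1 e1 e0 (by rwa [add_comm (p 1 ^ 2)])
    · exact eq_zero_of_critical n2 nm2 nm1 e2 (by rwa [add_comm (p 2 ^ 2)])
        (by rwa [add_comm (p 2 ^ 2)])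
end

section
/- Let λ ∈ ℂ and H = x⁴ + y⁴ + z⁴ + λ(y²z² + x²z² + x²y²) ∈ ℂ[x,y,z]. Then, with b₀,…,b₄, h₂, h₃ as defined from H, one has h₂ = u⁴·g₄ and h₃ = u⁶·g₆ in ℂ[s,t,u], where g₄ = ((λ² + 12)/3)·(s⁴ + t⁴ + u⁴) + (2(λ² + 6λ)/3)·(t²u² + s²u² + s²t²) and g₆ = (2(−λ³ + 12λ² + 12λ)/9)·(t⁴u² + t²u⁴ + s⁴u² + s²u⁴ + s⁴t² + s²t⁴) + (2(−λ³ + 36λ)/27)·(s⁶ + t⁶ + u⁶) + (4(8λ³ − 9λ² + 36)/9)·s²t²u². -/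
open MvPolynomial

/-- A binary quartic form over `ℂ` is determined by its values. -/
theorem binaryQuartic_coeff_unique {a₀ a₁ a₂ a₃ a₄ c₀ c₁ c₂ c₃ c₄ : ℂ}
    (h : ∀ x y : ℂ,
      a₀ * x ^ 4 + a₁ * x ^ 3 * y + a₂ * x ^ 2 * y ^ 2 + a₃ * x * y ^ 3 + a₄ * y ^ 4
        = c₀ * x ^ 4 + c₁ * x ^ 3 * y + c₂ * x ^ 2 * y ^ 2 + c₃ * x * y ^ 3 + c₄ * y ^ 4) :
    a₀ = c₀ ∧ a₁ = c₁ ∧ a₂ = c₂ ∧ a₃ = c₃ ∧ a₄ = c₄ := by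
  have h₀ : a₀ = c₀ := by linear_combination h 1 0
  have h₄ : a₄ = c₄ := by linear_combination h 0 1
  have h₂ : a₂ = c₂ := by
    linear_combination (1 / 2 : ℂ) * h 1 1 + (1 / 2 : ℂ) * h 1 (-1) - h₀ - h₄
  have h₁ : a₁ = c₁ := by
    linear_combination (1 / 6 : ℂ) * (h 2 1 - 16 * h₀ - 4 * h₂ - h₄)
      - (1 / 6 : ℂ) * (h 1 1 - h 1 (-1))
  have h₃ : a₃ = c₃ := by linear_combination (1 / 2 : ℂ) * (h 1 1 - h 1 (-1)) - h₁
  exact ⟨h₀, h₁, h₂, h₃, h₄⟩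

/-- Explicit formulae for the covariants `g₄` and `g₆` of the `S₄`-invariant plane quartic
`x⁴ + y⁴ + z⁴ + λ(y²z² + x²z² + x²y²)`: one has `h₂ = u⁴·g₄` and `h₃ = u⁶·g₆`. -/
theorem stmt_16 (lam : ℂ) (H : MvPolynomial (Fin 3) ℂ)
    (hH : H = X 0 ^ 4 + X 1 ^ 4 + X 2 ^ 4
      + C lam * (X 1 ^ 2 * X 2 ^ 2 + X 0 ^ 2 * X 2 ^ 2 + X 0 ^ 2 * X 1 ^ 2))
    (b₀ b₁ b₂ b₃ b₄ : MvPolynomial (Fin 3) ℂ)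
    (hb : ∀ s t u x y : ℂ,
      eval ![x * u, y * u, -(s * x + t * y)] H
        = eval ![s, t, u] b₀ * x ^ 4 + eval ![s, t, u] b₁ * x ^ 3 * y
          + eval ![s, t, u] b₂ * x ^ 2 * y ^ 2 + eval ![s, t, u] b₃ * x * y ^ 3
          + eval ![s, t, u] b₄ * y ^ 4)
    (h₂ h₃ : MvPolynomial (Fin 3) ℂ)
    (hh₂ : h₂ = C (1 / 3 : ℂ) * (-3 * b₁ * b₃ + 12 * b₀ * b₄ + b₂ ^ 2))
    (hh₃ : h₃ = C (1 / 27 : ℂ) * (72 * b₀ * b₂ * b₄ - 27 * b₀ * b₃ ^ 2 - 27 * b₁ ^ 2 * b₄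
      + 9 * b₁ * b₂ * b₃ - 2 * b₂ ^ 3)) :
    h₂ = X 2 ^ 4 * (C ((lam ^ 2 + 12) / 3) * (X 0 ^ 4 + X 1 ^ 4 + X 2 ^ 4)
          + C (2 * (lam ^ 2 + 6 * lam) / 3)
            * (X 1 ^ 2 * X 2 ^ 2 + X 0 ^ 2 * X 2 ^ 2 + X 0 ^ 2 * X 1 ^ 2))
    ∧ h₃ = X 2 ^ 6 * (C (2 * (-lam ^ 3 + 12 * lam ^ 2 + 12 * lam) / 9)
            * (X 1 ^ 4 * X 2 ^ 2 + X 1 ^ 2 * X 2 ^ 4 + X 0 ^ 4 * X 2 ^ 2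
              + X 0 ^ 2 * X 2 ^ 4 + X 0 ^ 4 * X 1 ^ 2 + X 0 ^ 2 * X 1 ^ 4)
          + C (2 * (-lam ^ 3 + 36 * lam) / 27) * (X 0 ^ 6 + X 1 ^ 6 + X 2 ^ 6)
          + C (4 * (8 * lam ^ 3 - 9 * lam ^ 2 + 36) / 9) * (X 0 ^ 2 * X 1 ^ 2 * X 2 ^ 2)) := by
  have coeffs (s t u : ℂ) :
      eval ![s, t, u] b₀ = u ^ 4 + s ^ 4 + lam * u ^ 2 * s ^ 2 ∧
      eval ![s, t, u] b₁ = 4 * s ^ 3 * t + 2 * lam * u ^ 2 * s * t ∧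
      eval ![s, t, u] b₂ = 6 * s ^ 2 * t ^ 2 + lam * (u ^ 2 * (s ^ 2 + t ^ 2) + u ^ 4) ∧
      eval ![s, t, u] b₃ = 4 * s * t ^ 3 + 2 * lam * u ^ 2 * s * t ∧
      eval ![s, t, u] b₄ = u ^ 4 + t ^ 4 + lam * u ^ 2 * t ^ 2 := by
    refine binaryQuartic_coeff_unique fun x y => ?_
    rw [← hb, hH]
    simp
    ring
  have eta (v : Fin 3 → ℂ) : v = ![v 0, v 1, v 2] := by
    ext i; fin_cases i <;> rfl
  subst hh₂ hh₃
  constructor <;>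
  · refine MvPolynomial.funext fun v => ?_
    rw [eta v]
    obtain ⟨e₀, e₁, e₂, e₃, e₄⟩ := coeffs (v 0) (v 1) (v 2)
    simp only [map_add, map_sub, map_mul, map_neg, map_pow, map_ofNat, eval_C, eval_X,
      e₀, e₁, e₂, e₃, e₄, Matrix.cons_val]
    ring
end

section
/- Let λ ∈ ℂ, set μ = 2λ/3, and let g₄ = ((λ² + 12)/3)·(s⁴ + t⁴ + u⁴) + (2(λ² + 6λ)/3)·(t²u² + s²u² + s²t²) and g₆ = (2(−λ³ + 12λ² + 12λ)/9)·(t⁴u² + t²u⁴ + s⁴u² + s²u⁴ + s⁴t² + s²t⁴) + (2(−λ³ + 36λ)/27)·(s⁶ + t⁶ + u⁶) + (4(8λ³ − 9λ² + 36)/9)·s²t²u². Then the identity μ³(s² + t² + u²)³ − μ(s² + t² + u²)·g₄ + g₆ = 4(λ − 2)²(λ + 1)·s²t²u² holds in ℂ[s,t,u]. Consequently, whenever γ² = 4(λ−2)²(λ+1), the hypersurface w² = v³ − g₄·v + g₆ contains the two surfaces defined by v = μ(s² + t² + u²), w = ±γ·stu. -/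
open MvPolynomial

/-- With `μ = 2λ/3` and the covariants `g₄, g₆` of the `S₄`-invariant quartic, the identity
`μ³(s²+t²+u²)³ − μ(s²+t²+u²)g₄ + g₆ = 4(λ−2)²(λ+1)s²t²u²` holds in `ℂ[s,t,u]`; consequently,
whenever `γ² = 4(λ−2)²(λ+1)`, the hypersurface `w² = v³ − g₄v + g₆` contains the two surfaces
`v = μ(s²+t²+u²), w = ±γstu`. -/
theorem stmt_17 (lam mu : ℂ) (hmu : mu = 2 * lam / 3)
    (g₄ g₆ : MvPolynomial (Fin 3) ℂ)
    (hg₄ : g₄ = C ((lam ^ 2 + 12) / 3) * (X 0 ^ 4 + X 1 ^ 4 + X 2 ^ 4)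
      + C (2 * (lam ^ 2 + 6 * lam) / 3)
        * (X 1 ^ 2 * X 2 ^ 2 + X 0 ^ 2 * X 2 ^ 2 + X 0 ^ 2 * X 1 ^ 2))
    (hg₆ : g₆ = C (2 * (-lam ^ 3 + 12 * lam ^ 2 + 12 * lam) / 9)
        * (X 1 ^ 4 * X 2 ^ 2 + X 1 ^ 2 * X 2 ^ 4 + X 0 ^ 4 * X 2 ^ 2
          + X 0 ^ 2 * X 2 ^ 4 + X 0 ^ 4 * X 1 ^ 2 + X 0 ^ 2 * X 1 ^ 4)
      + C (2 * (-lam ^ 3 + 36 * lam) / 27) * (X 0 ^ 6 + X 1 ^ 6 + X 2 ^ 6)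
      + C (4 * (8 * lam ^ 3 - 9 * lam ^ 2 + 36) / 9) * (X 0 ^ 2 * X 1 ^ 2 * X 2 ^ 2)) :
    (C (mu ^ 3) * (X 0 ^ 2 + X 1 ^ 2 + X 2 ^ 2) ^ 3
        - C mu * (X 0 ^ 2 + X 1 ^ 2 + X 2 ^ 2) * g₄ + g₆
      = C (4 * (lam - 2) ^ 2 * (lam + 1)) * (X 0 ^ 2 * X 1 ^ 2 * X 2 ^ 2))
    ∧ ∀ gam : ℂ, gam ^ 2 = 4 * (lam - 2) ^ 2 * (lam + 1) →
        ∀ s t u w : ℂ, (w = gam * s * t * u ∨ w = -(gam * s * t * u)) →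
          w ^ 2 = (mu * (s ^ 2 + t ^ 2 + u ^ 2)) ^ 3
            - eval ![s, t, u] g₄ * (mu * (s ^ 2 + t ^ 2 + u ^ 2)) + eval ![s, t, u] g₆ := by
  subst hmu hg₄ hg₆
  refine ⟨MvPolynomial.funext fun x => ?_, fun gam hgam s t u w hw => ?_⟩
  · simp only [map_add, map_sub, map_mul, map_pow, eval_C, eval_X]
    ring
  · have hw2 : w ^ 2 = gam ^ 2 * (s ^ 2 * t ^ 2 * u ^ 2) := by
      rcases hw with rfl | rfl <;> ring
    rw [hw2, hgam]
    simp only [map_add, map_mul, map_pow, eval_C, eval_X, Matrix.cons_val]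
    ring
end

section
/- Let A, B ∈ ℂ with B ≠ 0. Then the binary sextic form A(t² + u²)³ + B(t² + u²)t²u² ∈ ℂ[t,u] is nonzero and is not the square of any binary cubic form a₃t³ + a₂t²u + a₁tu² + a₀u³ with a₀, a₁, a₂, a₃ ∈ ℂ. -/
open MvPolynomial

/-- If `q` vanishes at a point, then all partial derivatives of `q ^ 2` vanish there. -/
lemma eval_pderiv_sq_eq_zero {σ R : Type*} [CommRing R] [IsReduced R] (q : MvPolynomial σ R)
    (i : σ) (x : σ → R) (h : eval x (q ^ 2) = 0) : eval x (pderiv i (q ^ 2)) = 0 := by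
  rw [map_pow, sq_eq_zero_iff] at h
  simp [pow_two, Derivation.leibniz, h]

/-- The form `A(t²+u²)³ + B(t²+u²)t²u²` with `B ≠ 0` has a simple zero at `(i, 1)`, so it is not
a square. -/
lemma sextic_ne_sq (A B : ℂ) (hB : B ≠ 0) (q : MvPolynomial (Fin 2) ℂ) :
    C A * (X 0 ^ 2 + X 1 ^ 2) ^ 3 + C B * (X 0 ^ 2 + X 1 ^ 2) * X 0 ^ 2 * X 1 ^ 2 ≠ q ^ 2 := by
  intro h
  have hd := eval_pderiv_sq_eq_zero q 0 ![Complex.I, 1] (by rw [← h]; simp)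
  rw [← h] at hd
  simp [Derivation.leibniz, Derivation.leibniz_pow, pderiv_X, hB] at hd

/-- A binary sextic of the form `A(t²+u²)³ + B(t²+u²)t²u²` with `B ≠ 0` is nonzero and is not
the square of any binary cubic form. -/
theorem stmt_18 (A B : ℂ) (hB : B ≠ 0)
    (P : MvPolynomial (Fin 2) ℂ)
    (hP : P = C A * (X 0 ^ 2 + X 1 ^ 2) ^ 3 + C B * (X 0 ^ 2 + X 1 ^ 2) * X 0 ^ 2 * X 1 ^ 2) :
    P ≠ 0 ∧ ∀ a₀ a₁ a₂ a₃ : ℂ,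
      P ≠ (C a₃ * X 0 ^ 3 + C a₂ * X 0 ^ 2 * X 1 + C a₁ * X 0 * X 1 ^ 2 + C a₀ * X 1 ^ 3) ^ 2 := by
  subst hP
  exact ⟨by simpa using sextic_ne_sq A B hB 0, fun _ _ _ _ => sextic_ne_sq A B hB _⟩
end
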